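/- Let p, q, r be real numbers with 0 < p < 1, 0 ≤ q ≤ 1 and 0 ≤ r ≤ 1. If p² ≤ q·r and (1−p)² ≤ (1−q)·(1−r), then q = p and r = p. -/

import Mathlib

/-- the elementary real inequality system forcing q = p and r = p. -/
theorem stmt_8 (p q r : ℝ) (hp0 : 0 < p) (hp1 : p < 1) (hq0 : 0 ≤ q) (hq1 : q ≤ 1)
    (hr0 : 0 ≤ r) (hr1 : r ≤ 1)
    (h1 : p ^ 2 ≤ q * r) (h2 : (1 - p) ^ 2 ≤ (1 - q) * (1 - r)) :
    q = p ∧ r = p := by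
  have hle : p ≤ (q + r) / 2 :=
    pow_le_pow_iff_left₀ (by linarith) (by linarith) two_ne_zero |>.mp
      (by nlinarith [sq_nonneg (q - r)])
  have hge : 1 - p ≤ 1 - (q + r) / 2 :=
    pow_le_pow_iff_left₀ (by linarith) (by linarith) two_ne_zero |>.mp
      (by nlinarith [sq_nonneg (q - r)])
  have hr : r = 2 * p - q := by linarith
  subst hr
  have hq : q - p = 0 := pow_eq_zero_iff two_ne_zero |>.mp
    (le_antisymm (by nlinarith) (sq_nonneg (q - p)))
  constructor <;> linarith
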